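/- The action of W on Υ_reg is free and properly discontinuous. -/

import Mathlib

noncomputable def coxEntry {B : Type*} (M : CoxeterMatrix B) (s t : B) : ℝ :=
  if M s t = 0 then -2 else -2 * Real.cos (Real.pi / (M s t))

noncomputable def coxForm {B : Type*} [Fintype B] (M : CoxeterMatrix B) (v w : B → ℝ) : ℝ :=
  ∑ s, ∑ t, v s * w t * coxEntry M s t

/-- The simple root `α_s` in `RΛ ≅ (B → ℝ)`. -/
noncomputable def simpleRoot {B : Type*} [DecidableEq B] (s : B) : B → ℝ := Pi.single s 1

/-- The set of real roots: the `W`-orbit of the simple roots under the Tits representation. -/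
def rootSet {B : Type*} [DecidableEq B] {W : Type*} [Group W]
    (ρ : W →* ((B → ℝ) ≃ₗ[ℝ] (B → ℝ))) : Set (B → ℝ) :=
  {v | ∃ (w : W) (s : B), v = ρ w (simpleRoot s)}

/-- The set of positive real roots. -/
def posRootSet {B : Type*} [DecidableEq B] {W : Type*} [Group W]
    (ρ : W →* ((B → ℝ) ≃ₗ[ℝ] (B → ℝ))) : Set (B → ℝ) :=
  {v ∈ rootSet ρ | ∀ i, 0 ≤ v i}

/-- The set `K = {v ∈ ℝ_{≥0}Λ : B(v, α_s) ≤ 0 for all s}`. -/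
noncomputable def coneK {B : Type*} [Fintype B] [DecidableEq B] (M : CoxeterMatrix B) :
    Set (B → ℝ) :=
  {v | (∀ i, 0 ≤ v i) ∧ ∀ s, coxForm M v (simpleRoot s) ≤ 0}

/-- The closed imaginary cone `I = closure (W · K)`. -/
noncomputable def imagCone {B : Type*} [Fintype B] [DecidableEq B] (M : CoxeterMatrix B)
    {W : Type*} [Group W] (ρ : W →* ((B → ℝ) ≃ₗ[ℝ] (B → ℝ))) : Set (B → ℝ) :=
  closure {v | ∃ (w : W), ∃ k ∈ coneK M, v = ρ w k}


/-- The pairing between the complexified dual space `(RΛ)*_ℂ = Hom_ℝ(RΛ, ℂ)` (in coordinates: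
`z : B → ℂ`, with `z i = Z(α_i)`) and `RΛ`. -/
noncomputable def evalC {B : Type*} [Fintype B] (z : B → ℂ) (v : B → ℝ) : ℂ := ∑ i, (v i : ℂ) * z i

/-- The hyperplane complement `Υ_reg`: the complement in `(RΛ)*_ℂ` of the hyperplanes `H_v`
for nonzero `v` in the closed imaginary cone and the hyperplanes `H_α` for positive real
roots `α`. -/
noncomputable def upsReg {B : Type*} [Fintype B] [DecidableEq B] (M : CoxeterMatrix B)
    {W : Type*} [Group W] (ρ : W →* ((B → ℝ) ≃ₗ[ℝ] (B → ℝ))) : Set (B → ℂ) :=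
  {z | (∀ v ∈ imagCone M ρ, v ≠ 0 → evalC z v ≠ 0) ∧ ∀ α ∈ posRootSet ρ, evalC z α ≠ 0}

/-- The argument `φ^I(Z)` of the middle ray of the proper closed convex cone `Z(I) ⊆ ℂ`
(for `Z ∈ Υ` with `I ≠ {0}`): the average of the extremal arguments of `Z(I \ {0})`. -/
noncomputable def phiI {B : Type*} [Fintype B] [DecidableEq B] (M : CoxeterMatrix B)
    {W : Type*} [Group W] (ρ : W →* ((B → ℝ) ≃ₗ[ℝ] (B → ℝ))) (z : B → ℂ) : ℝ :=
  (sSup (Complex.arg '' ((fun v => evalC z v) '' (imagCone M ρ \ {0}))) +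
    sInf (Complex.arg '' ((fun v => evalC z v) '' (imagCone M ρ \ {0})))) / 2

open Classical in
/-- The normalised hyperplane complement `Υ_reg^N = {Z ∈ Υ_reg : φ^I(Z) = π/2}`; by
convention `Υ_reg^N := Υ_reg` when `I = {0}`. -/
noncomputable def upsRegN {B : Type*} [Fintype B] [DecidableEq B] (M : CoxeterMatrix B)
    {W : Type*} [Group W] (ρ : W →* ((B → ℝ) ≃ₗ[ℝ] (B → ℝ))) : Set (B → ℂ) :=
  if imagCone M ρ = {0} then upsReg M ρ
  else {z ∈ upsReg M ρ | phiI M ρ z = Real.pi / 2}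

/-- The contragredient action of `w ∈ W` on the complexified dual space, in coordinates:
`(w · Z)(v) = Z(ρ(w⁻¹) v)`. -/
noncomputable def wact {B : Type*} [Fintype B] [DecidableEq B]
    {W : Type*} [Group W] (ρ : W →* ((B → ℝ) ≃ₗ[ℝ] (B → ℝ))) (w : W) (z : B → ℂ) :
    B → ℂ :=
  fun i => evalC z (ρ w⁻¹ (simpleRoot i))


section Helpers

variable {B : Type*} [Fintype B] [DecidableEq B] (M : CoxeterMatrix B)

lemma coxEntry_comm (s t : B) : coxEntry M s t = coxEntry M t s := by
  unfold coxEntry; rw [M.symmetric s t]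

lemma coxEntry_self (s : B) : coxEntry M s s = 2 := by
  simp [coxEntry]

lemma coxEntry_nonpos {s t : B} (h : s ≠ t) : coxEntry M s t ≤ 0 := by
  unfold coxEntry
  split_ifs with h0
  · norm_num
  · have h1 := M.off_diagonal s t h
    have h2 : (2 : ℝ) ≤ M s t := by
      have : 2 ≤ M s t := by omega
      exact_mod_cast this
    have : 0 ≤ Real.cos (Real.pi / (M s t)) := by
      apply Real.cos_nonneg_of_mem_Icc
      constructor
      · have : 0 ≤ Real.pi / (M s t : ℝ) := by positivity
        linarith [Real.pi_pos]
      · apply div_le_div_of_nonneg_left Real.pi_pos.le (by norm_num) h2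
    linarith

/-- The form as a bilinear map. -/
noncomputable def cf : (B → ℝ) →ₗ[ℝ] (B → ℝ) →ₗ[ℝ] ℝ :=
  LinearMap.mk₂ ℝ (coxForm M)
    (by intro a b c; simp only [coxForm, Pi.add_apply, add_mul, Finset.sum_add_distrib])
    (by intro a b c
        simp only [coxForm, Pi.smul_apply, smul_eq_mul, Finset.mul_sum]
        refine Finset.sum_congr rfl fun i _ => Finset.sum_congr rfl fun j _ => by ring)
    (by intro a b c; simp only [coxForm, Pi.add_apply, mul_add, add_mul, Finset.sum_add_distrib])
    (by intro a b c
        simp only [coxForm, Pi.smul_apply, smul_eq_mul, Finset.mul_sum]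
        refine Finset.sum_congr rfl fun i _ => Finset.sum_congr rfl fun j _ => by ring)

lemma cf_apply (v w : B → ℝ) : cf M v w = coxForm M v w := rfl

lemma cf_comm (v w : B → ℝ) : cf M v w = cf M w v := by
  simp only [cf_apply, coxForm]
  rw [Finset.sum_comm]
  refine Finset.sum_congr rfl fun i _ => Finset.sum_congr rfl fun j _ => ?_
  rw [coxEntry_comm M i j]; ring

lemma cf_simple_simple (s t : B) : cf M (simpleRoot s) (simpleRoot t) = coxEntry M s t := by
  simp only [cf_apply, coxForm, simpleRoot]
  rw [Finset.sum_eq_single s, Finset.sum_eq_single t]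
  · simp
  · intro b _ hb; simp [hb]
  · simp
  · intro b _ hb; simp [hb]
  · simp

lemma vec_eq_sum (v : B → ℝ) : v = ∑ i, v i • simpleRoot i := by
  ext j
  simp [simpleRoot, Finset.sum_apply, Pi.single_apply]

lemma cf_eq_sum_right (v w : B → ℝ) : cf M v w = ∑ i, w i * cf M v (simpleRoot i) := by
  conv_lhs => rw [vec_eq_sum w]
  simp [map_sum]

lemma cf_simple_eq_sum (v : B → ℝ) (s : B) :
    cf M v (simpleRoot s) = ∑ i, v i * coxEntry M s i := by
  rw [cf_comm, cf_eq_sum_right]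
  simp [cf_simple_simple]

variable {W : Type*} [Group W] (cs : CoxeterSystem M W)
    (ρ : W →* ((B → ℝ) ≃ₗ[ℝ] (B → ℝ)))

/-- The hypothesis that `ρ` is the Tits representation. -/
def IsTits : Prop := ∀ (s : B) (v : B → ℝ),
      ρ (cs.simple s) v = v - coxForm M (simpleRoot s) v • simpleRoot s

lemma rho_mul (u w : W) (v : B → ℝ) : ρ (u * w) v = ρ u (ρ w v) := by
  rw [map_mul]; rfl

lemma rho_inv_self (w : W) (v : B → ℝ) : ρ w⁻¹ (ρ w v) = v := by
  rw [← rho_mul]; simp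

lemma rho_self_inv (w : W) (v : B → ℝ) : ρ w (ρ w⁻¹ v) = v := by
  rw [← rho_mul]; simp

variable {M cs ρ}

lemma IsTits.app (h : IsTits M cs ρ) (s : B) (v : B → ℝ) :
    ρ (cs.simple s) v = v - cf M v (simpleRoot s) • simpleRoot s := by
  rw [h s v, cf_comm]; rfl

lemma IsTits.simple_self (h : IsTits M cs ρ) (s : B) :
    ρ (cs.simple s) (simpleRoot s) = - simpleRoot s := by
  rw [h.app, cf_simple_simple, coxEntry_self, two_smul]; abel

lemma IsTits.simple_simple (h : IsTits M cs ρ) (s t : B) :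
    ρ (cs.simple t) (simpleRoot s) = simpleRoot s - coxEntry M s t • simpleRoot t := by
  rw [h.app, cf_simple_simple]

lemma rho_ss (s : B) (v : B → ℝ) : ρ (cs.simple s) (ρ (cs.simple s) v) = v := by
  rw [← rho_mul]; simp

lemma IsTits.cf_inv (h : IsTits M cs ρ) (w : W) (a b : B → ℝ) :
    cf M (ρ w a) (ρ w b) = cf M a b := by
  induction w using cs.simple_induction_left with
  | one => simp
  | mul_simple_left w s ih =>
    rw [rho_mul, rho_mul, ← ih]
    generalize ρ w a = a
    generalize ρ w b = b
    rw [h.app, h.app]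
    simp only [map_sub, map_smul, LinearMap.sub_apply, LinearMap.smul_apply, cf_simple_simple,
      coxEntry_self, smul_eq_mul]
    rw [cf_comm M (simpleRoot s) b]
    ring

/-- Coefficients for dihedral computation. -/
noncomputable def dihC (M : CoxeterMatrix B) (s t : B) (k : ℕ) : ℝ :=
  if M s t = 0 then k else Real.sin (k * (Real.pi / M s t)) / Real.sin (Real.pi / M s t)

lemma sin_pi_div_pos {m : ℕ} (h0 : m ≠ 0) (h1 : m ≠ 1) : 0 < Real.sin (Real.pi / m) := by
  have h2 : (2 : ℝ) ≤ m := by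
    have : 2 ≤ m := by omega
    exact_mod_cast this
  apply Real.sin_pos_of_pos_of_lt_pi
  · have := Real.pi_pos
    positivity
  · rw [div_lt_iff₀ (by linarith)]
    nlinarith [Real.pi_pos]

lemma dihC_zero (s t : B) : dihC M s t 0 = 0 := by
  unfold dihC; split_ifs <;> simp

lemma dihC_one {s t : B} (h : s ≠ t) : dihC M s t 1 = 1 := by
  unfold dihC
  split_ifs with h0
  · simp
  · have := (sin_pi_div_pos h0 (M.off_diagonal s t h)).ne'
    simp only [Nat.cast_one, one_mul]
    exact div_self this

lemma dihC_rec (s t : B) (k : ℕ) :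
    dihC M s t (k + 2) = - coxEntry M s t * dihC M s t (k + 1) - dihC M s t k := by
  unfold dihC coxEntry
  split_ifs with h0
  · push_cast; ring
  · set θ := Real.pi / (M s t : ℝ)
    have e1 : ((k + 2 : ℕ) : ℝ) * θ = ((k + 1 : ℕ) : ℝ) * θ + θ := by push_cast; ring
    have e2 : (k : ℝ) * θ = ((k + 1 : ℕ) : ℝ) * θ - θ := by push_cast; ring
    rw [e1, e2, Real.sin_add, Real.sin_sub]
    ring

lemma dihC_nonneg {s t : B} (h : s ≠ t) {k : ℕ} (hk : M s t = 0 ∨ k ≤ M s t) :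
    0 ≤ dihC M s t k := by
  unfold dihC
  split_ifs with h0
  · positivity
  · have hs := sin_pi_div_pos h0 (M.off_diagonal s t h)
    apply div_nonneg _ hs.le
    have hk' : (k : ℝ) ≤ M s t := by exact_mod_cast hk.resolve_left h0
    have hm : (0 : ℝ) < M s t := by positivity
    apply Real.sin_nonneg_of_nonneg_of_le_pi
    · have := Real.pi_pos
      positivity
    · rw [← mul_div_assoc, div_le_iff₀ hm]
      nlinarith [Real.pi_pos]

open CoxeterSystem in
lemma IsTits.alt_apply (h : IsTits M cs ρ) {s t : B} (hst : s ≠ t) (k : ℕ) :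
    ρ (cs.wordProd (alternatingWord s t k)) (simpleRoot s) =
      if Even k then dihC M s t (k + 1) • simpleRoot s + dihC M s t k • simpleRoot t
      else dihC M s t (k + 1) • simpleRoot t + dihC M s t k • simpleRoot s := by
  induction k with
  | zero => simp [alternatingWord, dihC_zero, dihC_one hst]
  | succ k ih =>
    rw [alternatingWord_succ', wordProd_cons, rho_mul, ih]
    by_cases hk : Even k
    · have : ¬ Even (k + 1) := by simp [hk, parity_simps]
      simp only [hk, this, if_true, if_false, map_add, map_smul, h.simple_self, h.simple_simple,
        dihC_rec]
      module
    · have : Even (k + 1) := by simp [hk, parity_simps]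
      simp only [hk, this, if_true, if_false, map_add, map_smul, h.simple_self, h.simple_simple,
        dihC_rec, coxEntry_comm M t s]
      module

lemma simpleRoot_nonneg (s : B) : (0 : B → ℝ) ≤ simpleRoot s := by
  unfold simpleRoot
  exact Pi.single_nonneg.2 zero_le_one

open CoxeterSystem in
theorem IsTits.pos_of_length (h : IsTits M cs ρ) : ∀ (n : ℕ) (w : W) (s : B),
    cs.length w = n → cs.length (w * cs.simple s) = n + 1 → 0 ≤ ρ w (simpleRoot s) := by
  classical
  intro n
  induction n using Nat.strong_induction_on with
  | _ n ih =>
  intro w s hw hws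
  by_cases h1 : w = 1
  · subst h1
    simpa using simpleRoot_nonneg s
  obtain ⟨t, ht⟩ := cs.exists_rightDescent_of_ne_one h1
  have hts : s ≠ t := by
    rintro rfl
    unfold IsRightDescent at ht
    omega
  rw [isRightDescent_iff] at ht
  let P : ℕ → Prop := fun k => cs.length (w * (cs.wordProd (alternatingWord s t k))⁻¹) + k = n
  have hP1 : P 1 := by
    simp only [P, alternatingWord]
    simp
    omega
  set k := Nat.findGreatest P n with hk
  have hn : 1 ≤ n := by omega
  have hPk : P k := Nat.findGreatest_spec hn hP1
  have hk1 : 1 ≤ k := Nat.le_findGreatest hn hP1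
  have hPk' : ¬ P (k + 1) := by
    intro hh
    have : k + 1 ≤ n := by simp only [P] at hh; omega
    have := Nat.le_findGreatest this hh
    omega
  set a := cs.wordProd (alternatingWord s t k) with ha
  set v := w * a⁻¹ with hv
  have hwva : w = v * a := by simp [hv]
  have hvl : cs.length v + k = n := hPk
  -- both letters are ascents of v
  have key : ∀ x y : B, (x = s ∧ y = t ∧ Even k) ∨ (x = t ∧ y = s ∧ ¬ Even k) →
      cs.length (v * cs.simple x) = cs.length v + 1 ∧
      cs.length (v * cs.simple y) = cs.length v + 1 := by
    intro x y hxy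
    constructor
    · -- x : first letter of a
      obtain ⟨j, hj⟩ : ∃ j, k = j + 1 := ⟨k - 1, by omega⟩
      have hax : a = cs.simple x * cs.wordProd (alternatingWord s t j) := by
        rw [ha, hj, alternatingWord_succ', wordProd_cons]
        rw [hj] at hxy
        rcases hxy with ⟨rfl, rfl, he⟩ | ⟨rfl, rfl, he⟩
        · have : ¬ Even j := by simpa [parity_simps] using he
          simp [this]
        · have : Even j := by simpa [parity_simps] using he
          simp [this]
      have h2 : w = (v * cs.simple x) * cs.wordProd (alternatingWord s t j) := by
        rw [mul_assoc, ← hax, ← hwva]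
      have h3 := cs.length_mul_le (v * cs.simple x) (cs.wordProd (alternatingWord s t j))
      rw [← h2, hw] at h3
      have h4 := cs.length_wordProd_le (alternatingWord s t j)
      rw [length_alternatingWord] at h4
      rcases cs.length_mul_simple v x with h5 | h5 <;> omega
    · -- y : next letter
      rcases cs.length_mul_simple v y with h5 | h5
      · exact h5
      · exfalso
        apply hPk'
        simp only [P]
        have : (if Even k then t else s) = y := by
          rcases hxy with ⟨rfl, rfl, he⟩ | ⟨rfl, rfl, he⟩ <;> simp [he]
        rw [alternatingWord_succ', wordProd_cons, this, mul_inv_rev, ← ha, ← mul_assoc, ← hv,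
          cs.inv_simple]
        omega
  have hst : 0 ≤ ρ v (simpleRoot s) ∧ 0 ≤ ρ v (simpleRoot t) := by
    by_cases he : Even k
    · obtain ⟨p, q⟩ := key s t (Or.inl ⟨rfl, rfl, he⟩)
      exact ⟨ih _ (by omega) v s rfl p, ih _ (by omega) v t rfl q⟩
    · obtain ⟨p, q⟩ := key t s (Or.inr ⟨rfl, rfl, he⟩)
      exact ⟨ih _ (by omega) v s rfl q, ih _ (by omega) v t rfl p⟩
  have hkm : M s t = 0 ∨ k + 1 ≤ M s t := by
    by_contra! hcon
    have h6 := cs.not_isReduced_alternatingWord t s (m := k + 1)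
      (by rw [M.symmetric]; exact hcon.1) (by rw [M.symmetric]; exact hcon.2)
    apply h6
    unfold CoxeterSystem.IsReduced
    have h7 : cs.wordProd (alternatingWord t s (k + 1)) = a * cs.simple s := by
      rw [alternatingWord_succ, wordProd_concat]
    have h8 := cs.length_mul_le v (a * cs.simple s)
    rw [← mul_assoc, ← hwva, hws] at h8
    have h9 := cs.length_wordProd_le (alternatingWord t s (k + 1))
    rw [h7] at h9 ⊢
    rw [length_alternatingWord] at h9 ⊢
    omega
  have c1 := dihC_nonneg (M := M) hts hkm
  have c2 : 0 ≤ dihC M s t k := dihC_nonneg hts (hkm.imp id (by omega))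
  rw [hwva, rho_mul, ha, h.alt_apply hts]
  split_ifs
  · rw [map_add, map_smul, map_smul]
    exact add_nonneg (smul_nonneg c1 hst.1) (smul_nonneg c2 hst.2)
  · rw [map_add, map_smul, map_smul]
    exact add_nonneg (smul_nonneg c1 hst.2) (smul_nonneg c2 hst.1)

theorem IsTits.pos_of_asc (h : IsTits M cs ρ) {w : W} {s : B}
    (hws : cs.length (w * cs.simple s) = cs.length w + 1) : 0 ≤ ρ w (simpleRoot s) :=
  h.pos_of_length _ w s rfl hws

theorem IsTits.neg_of_desc (h : IsTits M cs ρ) {w : W} {s : B}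
    (hws : cs.length (w * cs.simple s) + 1 = cs.length w) : ρ w (simpleRoot s) ≤ 0 := by
  have := h.pos_of_asc (w := w * cs.simple s) (s := s) (by simp [hws])
  rw [rho_mul, h.simple_self, map_neg] at this
  simpa using this

lemma simpleRoot_mem_pos (s : B) : simpleRoot s ∈ posRootSet ρ :=
  ⟨⟨1, s, by simp⟩, simpleRoot_nonneg s⟩

lemma rho_mem_rootSet {v : B → ℝ} (hv : v ∈ rootSet ρ) (w : W) : ρ w v ∈ rootSet ρ := by
  obtain ⟨u, s, rfl⟩ := hv
  exact ⟨w * u, s, by rw [rho_mul]⟩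

lemma IsTits.pos_or_neg (h : IsTits M cs ρ) {v : B → ℝ} (hv : v ∈ rootSet ρ) :
    0 ≤ v ∨ v ≤ 0 := by
  obtain ⟨w, s, rfl⟩ := hv
  rcases cs.length_mul_simple w s with h1 | h1
  · exact Or.inl (h.pos_of_asc h1)
  · exact Or.inr (h.neg_of_desc h1)

lemma IsTits.cf_root (h : IsTits M cs ρ) {v : B → ℝ} (hv : v ∈ rootSet ρ) : cf M v v = 2 := by
  obtain ⟨w, s, rfl⟩ := hv
  rw [h.cf_inv, cf_simple_simple, coxEntry_self]

lemma IsTits.root_ne_zero (h : IsTits M cs ρ) {v : B → ℝ} (hv : v ∈ rootSet ρ) : v ≠ 0 := by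
  rintro rfl
  have := h.cf_root hv
  simp at this

lemma IsTits.simple_pos (h : IsTits M cs ρ) {v : B → ℝ} (hv : v ∈ posRootSet ρ) {s : B}
    (hs : v ≠ simpleRoot s) : ρ (cs.simple s) v ∈ posRootSet ρ := by
  have hr := rho_mem_rootSet hv.1 (cs.simple s)
  refine ⟨hr, ?_⟩
  rcases h.pos_or_neg hr with h1 | h1
  · exact h1
  exfalso
  have hz : ∀ j, j ≠ s → v j = 0 := by
    intro j hj
    have h2 := h1 j
    rw [h.app] at h2
    simp [simpleRoot, hj] at h2
    exact le_antisymm h2 (hv.2 j)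
  have hv' : v = v s • simpleRoot s := by
    ext j
    by_cases hj : j = s
    · subst hj; simp [simpleRoot]
    · simp [simpleRoot, hj, hz j hj]
  have h3 := h.cf_root hv.1
  rw [hv'] at h3
  simp only [map_smul, LinearMap.smul_apply, cf_simple_simple, coxEntry_self, smul_eq_mul] at h3
  have h4 := hv.2 s
  have h5 : v s = 1 := by nlinarith
  rw [h5, one_smul] at hv'
  exact hs hv'

lemma IsTits.inversions_finite (h : IsTits M cs ρ) (w : W) :
    {β | β ∈ posRootSet ρ ∧ ¬ 0 ≤ ρ w β}.Finite := by
  induction w using cs.simple_induction_left with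
  | one =>
    convert Set.finite_empty
    ext β
    simp only [map_one, LinearEquiv.coe_one, id, Set.mem_setOf_eq, Set.mem_empty_iff_false,
      iff_false, not_and, not_not]
    exact fun hb => hb.2
  | mul_simple_left w s ih =>
    refine (ih.union (Set.finite_singleton (ρ w⁻¹ (simpleRoot s)))).subset ?_
    rintro β ⟨h1, h2⟩
    by_cases h3 : 0 ≤ ρ w β
    · right
      by_contra h4
      apply h2
      rw [rho_mul]
      refine (h.simple_pos ⟨rho_mem_rootSet h1.1 w, h3⟩ ?_).2
      intro h5
      apply h4
      rw [Set.mem_singleton_iff, ← h5, rho_inv_self]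
    · left
      exact ⟨h1, h3⟩

lemma IsTits.exists_chamber (h : IsTits M cs ρ) : ∀ (n : ℕ) (f : (B → ℝ) →ₗ[ℝ] ℝ),
    {β | β ∈ posRootSet ρ ∧ f β < 0}.Finite → {β | β ∈ posRootSet ρ ∧ f β < 0}.ncard = n →
    ∃ w : W, ∀ s, 0 ≤ f (ρ w (simpleRoot s)) := by
  intro n
  induction n using Nat.strong_induction_on with
  | _ n ih =>
  intro f hf hn
  by_cases hall : ∀ s, 0 ≤ f (simpleRoot s)
  · exact ⟨1, by simpa using hall⟩
  push Not at hall
  obtain ⟨s, hs⟩ := hall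
  let g : (B → ℝ) →ₗ[ℝ] ℝ := f ∘ₗ (ρ (cs.simple s)).toLinearMap
  have hg : ∀ v, g v = f (ρ (cs.simple s) v) := fun v => rfl
  have hsub : {β | β ∈ posRootSet ρ ∧ g β < 0} ⊆
      (ρ (cs.simple s)) '' ({β | β ∈ posRootSet ρ ∧ f β < 0} \ {simpleRoot s}) := by
    rintro β ⟨h1, h2⟩
    rw [hg] at h2
    have h3 : β ≠ simpleRoot s := by
      rintro rfl
      rw [h.simple_self, map_neg] at h2
      linarith
    refine ⟨ρ (cs.simple s) β, ⟨⟨h.simple_pos h1 h3, h2⟩, ?_⟩, rho_ss s β⟩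
    intro h4
    rw [Set.mem_singleton_iff] at h4
    have h5 : β = - simpleRoot s := by rw [← h.simple_self, ← h4, rho_ss]
    have h6 := h1.2 s
    rw [h5] at h6
    simp [simpleRoot] at h6
    linarith
  have hfin := (hf.sdiff (t := {simpleRoot s})).image (ρ (cs.simple s))
  have hlt : {β | β ∈ posRootSet ρ ∧ g β < 0}.ncard < n := by
    refine lt_of_le_of_lt (Set.ncard_le_ncard hsub hfin) ?_
    refine lt_of_le_of_lt (Set.ncard_image_le (hf.sdiff)) ?_
    rw [← hn]
    exact Set.ncard_diff_singleton_lt_of_mem (⟨simpleRoot_mem_pos s, hs⟩) hf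
  obtain ⟨w, hw⟩ := ih _ hlt g (hfin.subset hsub) rfl
  refine ⟨cs.simple s * w, fun t => ?_⟩
  rw [rho_mul]
  exact hw t

/-- The dual of the Tits cone. -/
def pCone (ρ : W →* ((B → ℝ) ≃ₗ[ℝ] (B → ℝ))) : Set (B → ℝ) := {v | ∀ w : W, 0 ≤ ρ w v}

lemma rho_continuous (w : W) : Continuous (fun v => ρ w v) :=
  LinearMap.continuous_of_finiteDimensional (ρ w).toLinearMap

lemma pCone_closed : IsClosed (pCone ρ) := by
  have : pCone ρ = ⋂ w : W, (fun v => ρ w v) ⁻¹' (Set.Ici 0) := by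
    ext v; simp [pCone]
  rw [this]
  exact isClosed_iInter fun w => isClosed_Ici.preimage (rho_continuous w)

lemma pCone_nonneg {v : B → ℝ} (hv : v ∈ pCone ρ) : 0 ≤ v := by simpa using hv 1

lemma pCone_rho {v : B → ℝ} (hv : v ∈ pCone ρ) (w : W) : ρ w v ∈ pCone ρ := by
  intro u
  rw [← rho_mul]; exact hv _

lemma pCone_add {a b : B → ℝ} (ha : a ∈ pCone ρ) (hb : b ∈ pCone ρ) : a + b ∈ pCone ρ := by
  intro u
  rw [map_add]; exact add_nonneg (ha u) (hb u)

lemma pCone_smul {a : B → ℝ} (ha : a ∈ pCone ρ) {t : ℝ} (ht : 0 ≤ t) : t • a ∈ pCone ρ := by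
  intro u
  rw [map_smul]; exact smul_nonneg ht (ha u)

lemma mem_coneK {v : B → ℝ} : v ∈ coneK M ↔ 0 ≤ v ∧ ∀ s, cf M v (simpleRoot s) ≤ 0 := Iff.rfl

lemma IsTits.coneK_sub (h : IsTits M cs ρ) {k : B → ℝ} (hk : k ∈ coneK M) : k ∈ pCone ρ := by
  have key : ∀ (n : ℕ) (w : W), cs.length w = n → 0 ≤ ρ w k := by
    intro n
    induction n using Nat.strong_induction_on with
    | _ n ih =>
    intro w hw
    by_cases h1 : w = 1
    · subst h1; simpa using (mem_coneK.1 hk).1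
    obtain ⟨s, hs⟩ := cs.exists_rightDescent_of_ne_one h1
    rw [cs.isRightDescent_iff] at hs
    have e : ρ w k = ρ (w * cs.simple s) k +
        (- cf M k (simpleRoot s)) • ρ (w * cs.simple s) (simpleRoot s) := by
      conv_lhs => rw [← cs.simple_mul_simple_cancel_right (w := w) s, rho_mul, h.app]
      rw [map_sub, map_smul]
      module
    rw [e]
    refine add_nonneg (ih _ (by omega) _ rfl) (smul_nonneg ?_ (h.pos_of_asc ?_))
    · have := (mem_coneK.1 hk).2 s
      linarith
    · simp [hs]
  exact fun w => key _ w rfl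

lemma IsTits.imagCone_sub (h : IsTits M cs ρ) : imagCone M ρ ⊆ pCone ρ := by
  refine closure_minimal ?_ pCone_closed
  rintro v ⟨w, k, hk, rfl⟩
  exact pCone_rho (h.coneK_sub hk) w

/-- Limit roots lie in the dual of the Tits cone. -/
lemma IsTits.limit_root (h : IsTits M cs ρ) {S : Set (B → ℝ)} (hS : S ⊆ posRootSet ρ)
    (hinf : S.Infinite) : ∃ u ∈ pCone ρ, ‖u‖ = 1 ∧ u ∈ closure ((fun β => ‖β‖⁻¹ • β) '' S) := by
  let b : ℕ → (B → ℝ) := fun n => (hinf.natEmbedding S n : B → ℝ)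
  have hb : ∀ n, b n ∈ S := fun n => (hinf.natEmbedding S n).2
  have hbi : Function.Injective b :=
    Subtype.val_injective.comp (hinf.natEmbedding S).injective
  let c : ℕ → (B → ℝ) := fun n => ‖b n‖⁻¹ • b n
  have hc : ∀ n, c n ∈ Metric.sphere (0 : B → ℝ) 1 := by
    intro n
    have : ‖b n‖ ≠ 0 := norm_ne_zero_iff.2 (h.root_ne_zero (hS (hb n)).1)
    simp [c, norm_smul, this]
  obtain ⟨u, hu, φ, hφ, hlim⟩ := (isCompact_sphere (0 : B → ℝ) 1).tendsto_subseq hc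
  refine ⟨u, ?_, by simpa using hu, ?_⟩
  · intro w
    have h1 := ((rho_continuous (ρ := ρ) w).tendsto u).comp hlim
    refine ge_of_tendsto h1 ?_
    have h2 : {n | ¬ 0 ≤ ρ w (b (φ n))}.Finite := by
      have := (h.inversions_finite w).preimage ((hbi.comp hφ.injective).injOn)
      exact this.subset fun n hn => ⟨hS (hb _), hn⟩
    have h3 := h2.eventually_cofinite_notMem
    rw [Nat.cofinite_eq_atTop] at h3
    filter_upwards [h3] with n hn
    simp only [Set.mem_setOf_eq, not_not] at hn
    simp only [Function.comp, c, map_smul]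
    exact smul_nonneg (by positivity) hn
  · refine mem_closure_of_tendsto hlim (Filter.Eventually.of_forall fun n => ?_)
    exact ⟨b (φ n), hb _, rfl⟩

/-- Sum of coordinates. -/
noncomputable def ht : (B → ℝ) →ₗ[ℝ] ℝ := ∑ i, LinearMap.proj i

lemma ht_apply (v : B → ℝ) : ht v = ∑ i, v i := by simp [ht]

lemma ht_simple (s : B) : ht (simpleRoot s) = 1 := by
  simp [ht_apply, simpleRoot, Pi.single_apply]

lemma ht_nonneg {v : B → ℝ} (hv : 0 ≤ v) : 0 ≤ ht v := by
  rw [ht_apply]; exact Finset.sum_nonneg fun i _ => hv i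

lemma norm_le_ht {v : B → ℝ} (hv : 0 ≤ v) : ‖v‖ ≤ ht v := by
  refine (pi_norm_le_iff_of_nonneg (ht_nonneg hv)).2 fun i => ?_
  rw [Real.norm_of_nonneg (hv i), ht_apply]
  exact Finset.single_le_sum (f := v) (fun j _ => hv j) (Finset.mem_univ i)

lemma ht_cont : Continuous (ht : (B → ℝ) →ₗ[ℝ] ℝ) := LinearMap.continuous_of_finiteDimensional _

lemma cf_cont : Continuous (fun p : (B → ℝ) × (B → ℝ) => cf M p.1 p.2) := by
  have : (fun p : (B → ℝ) × (B → ℝ) => cf M p.1 p.2) =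
    fun p => ∑ s, ∑ t, p.1 s * p.2 t * coxEntry M s t := rfl
  rw [this]
  fun_prop

lemma cf_nonpos_of_coneK {a b : B → ℝ} (ha : ∀ s, cf M a (simpleRoot s) ≤ 0) (hb : 0 ≤ b) :
    cf M a b ≤ 0 := by
  rw [cf_eq_sum_right]
  exact Finset.sum_nonpos fun i _ => mul_nonpos_of_nonneg_of_nonpos (hb i) (ha i)

lemma IsTits.cf_aux (h : IsTits M cs ρ) {x u : B → ℝ} (hx : x ∈ pCone ρ) (hu : u ∈ pCone ρ) :
    cf M (x + u) x ≤ 0 := by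
  let O : Set ((B → ℝ) × (B → ℝ)) := Set.range fun w : W => (ρ w x, ρ w u)
  let C := closure O
  have hC1 : ∀ p ∈ C, 0 ≤ p.1 ∧ 0 ≤ p.2 ∧ cf M (p.1 + p.2) p.1 = cf M (x + u) x := by
    intro p hp
    have hcl : IsClosed {p : (B → ℝ) × (B → ℝ) | 0 ≤ p.1 ∧ 0 ≤ p.2 ∧
        cf M (p.1 + p.2) p.1 = cf M (x + u) x} := by
      refine (isClosed_le continuous_const continuous_fst).inter
        ((isClosed_le continuous_const continuous_snd).inter (isClosed_eq ?_ continuous_const))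
      exact cf_cont.comp (f := fun p : (B → ℝ) × (B → ℝ) => (p.1 + p.2, p.1)) (by fun_prop)
    refine closure_minimal ?_ hcl hp
    rintro _ ⟨w, rfl⟩
    refine ⟨hx w, hu w, ?_⟩
    show cf M (ρ w x + ρ w u) (ρ w x) = _
    rw [← map_add, h.cf_inv]
  have hC2 : ∀ p ∈ C, ∀ s, ((ρ (cs.simple s) p.1, ρ (cs.simple s) p.2) : _ × _) ∈ C := by
    intro p hp s
    have hcont : Continuous fun p : (B → ℝ) × (B → ℝ) =>
        ((ρ (cs.simple s) p.1, ρ (cs.simple s) p.2) : (B → ℝ) × (B → ℝ)) :=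
      ((rho_continuous _).comp continuous_fst).prodMk ((rho_continuous _).comp continuous_snd)
    refine map_mem_closure (f := fun p : (B → ℝ) × (B → ℝ) =>
        ((ρ (cs.simple s) p.1, ρ (cs.simple s) p.2) : (B → ℝ) × (B → ℝ))) hcont hp ?_
    rintro _ ⟨w, rfl⟩
    exact ⟨cs.simple s * w, by simp [rho_mul]⟩
  let F : (B → ℝ) × (B → ℝ) → ℝ := fun p => ht (p.1 + p.2)
  have hF : Continuous F := ht_cont.comp (by fun_prop)
  have hx0 : (x, u) ∈ C := subset_closure ⟨1, by simp⟩
  let D := C ∩ {p | F p ≤ F (x, u)}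
  have hDc : IsCompact D := by
    refine Metric.isCompact_of_isClosed_isBounded
      (isClosed_closure.inter (isClosed_le hF continuous_const)) ?_
    refine (Metric.isBounded_closedBall (x := 0) (r := F (x, u))).subset ?_
    rintro p ⟨hp, hp2⟩
    obtain ⟨p1, p2, -⟩ := hC1 p hp
    have a1 := norm_le_ht p1
    have a2 := norm_le_ht p2
    have a3 := ht_nonneg p1
    have a4 := ht_nonneg p2
    have a5 : ht p.1 + ht p.2 ≤ F (x, u) := by
      have : F p = ht p.1 + ht p.2 := map_add _ _ _
      rw [← this]; exact hp2
    rw [mem_closedBall_zero_iff, Prod.norm_def]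
    exact max_le (by linarith) (by linarith)
  obtain ⟨p, hpD, hmin⟩ := hDc.exists_isMinOn ⟨(x, u), hx0, le_refl (F (x, u))⟩ hF.continuousOn
  obtain ⟨p1, p2, p3⟩ := hC1 p hpD.1
  rw [← p3]
  refine cf_nonpos_of_coneK (fun s => ?_) p1
  by_contra! hcon
  let q : (B → ℝ) × (B → ℝ) := (ρ (cs.simple s) p.1, ρ (cs.simple s) p.2)
  have hq : F q = F p - cf M (p.1 + p.2) (simpleRoot s) := by
    show ht (ρ (cs.simple s) p.1 + ρ (cs.simple s) p.2) = ht (p.1 + p.2) - _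
    rw [← map_add, h.app, map_sub, map_smul, ht_simple, smul_eq_mul, mul_one]
  have hqD : q ∈ D := ⟨hC2 p hpD.1 s, by
    have := hpD.2
    simp only [Set.mem_setOf_eq] at this ⊢
    linarith⟩
  have := hmin hqD
  simp only [Set.mem_setOf_eq] at this
  linarith

lemma IsTits.cf_pCone (h : IsTits M cs ρ) {x u : B → ℝ} (hx : x ∈ pCone ρ) (hu : u ∈ pCone ρ) :
    cf M x u ≤ 0 := by
  have key : ∀ t : ℝ, 0 < t → t * cf M x x + cf M x u ≤ 0 := by
    intro t ht
    have := h.cf_aux (pCone_smul hx ht.le) hu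
    simp only [map_add, map_smul, LinearMap.add_apply, LinearMap.smul_apply, smul_eq_mul] at this
    rw [cf_comm M u x] at this
    have h2 : t * (t * cf M x x + cf M x u) ≤ 0 := by linarith
    by_contra! h3
    have := mul_pos ht h3
    linarith
  have hl : Filter.Tendsto (fun t : ℝ => t * cf M x x + cf M x u) (nhdsWithin 0 (Set.Ioi 0))
      (nhds (0 * cf M x x + cf M x u)) := by
    refine Filter.Tendsto.mono_left (Continuous.tendsto (by fun_prop) 0) nhdsWithin_le_nhds
  have := le_of_tendsto hl (by
    filter_upwards [self_mem_nhdsWithin] with t ht using key t ht)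
  simpa using this

lemma kkt {J : Set B} (hJ : ∀ s ∈ J, ∀ t ∉ J, coxEntry M s t = 0) {v : B → ℝ} (hv : 0 ≤ v)
    (hsupp : ∀ i ∈ J, v i = 0) {l : ℝ} (hl : l ≤ 0) (heq : cf M v v = l * ∑ i, v i ^ 2)
    (hmin : ∀ u : B → ℝ, 0 ≤ u → (∀ i ∈ J, u i = 0) → l * ∑ i, u i ^ 2 ≤ cf M u u) :
    v ∈ coneK M := by
  refine mem_coneK.2 ⟨hv, fun s => ?_⟩
  by_cases hs : s ∈ J
  · rw [cf_simple_eq_sum]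
    refine (Finset.sum_eq_zero fun i _ => ?_).le
    by_cases hi : i ∈ J
    · rw [hsupp i hi, zero_mul]
    · rw [hJ s hs i hi, mul_zero]
  by_cases h0 : v s = 0
  · rw [cf_simple_eq_sum]
    refine Finset.sum_nonpos fun i _ => ?_
    by_cases hi : i = s
    · rw [hi, h0, zero_mul]
    · exact mul_nonpos_of_nonneg_of_nonpos (hv i) (coxEntry_nonpos M (Ne.symm hi))
  have hpos : 0 < v s := lt_of_le_of_ne (hv s) (Ne.symm h0)
  by_contra! hc
  set c := cf M v (simpleRoot s) with hcdef
  obtain ⟨t, ht0, ht1, ht2⟩ : ∃ t : ℝ, 0 < t ∧ t ≤ v s ∧ t * (2 - l) ≤ c := by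
    have h2l : 0 < 2 - l := by linarith
    refine ⟨min (v s) (c / (2 - l)), lt_min hpos (div_pos hc h2l), min_le_left _ _, ?_⟩
    rw [← le_div_iff₀ h2l]
    exact min_le_right _ _
  have h1 := hmin (v - t • simpleRoot s) (by
      intro i
      by_cases hi : i = s
      · subst hi; simp [simpleRoot]; linarith
      · simp [simpleRoot, hi]; exact hv i) (by
      intro i hi
      have : i ≠ s := fun h => hs (h ▸ hi)
      simp [simpleRoot, this, hsupp i hi])
  have h2 : ∑ i, (v - t • simpleRoot s) i ^ 2 = ∑ i, v i ^ 2 - 2 * t * v s + t ^ 2 := by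
    have : ∀ i, (v - t • simpleRoot s) i ^ 2 =
        v i ^ 2 + (if i = s then - 2 * t * v s + t ^ 2 else 0) := by
      intro i
      by_cases hi : i = s
      · subst hi; simp [simpleRoot]; ring
      · simp [simpleRoot, hi]
    simp only [this, Finset.sum_add_distrib, Finset.sum_ite_eq', Finset.mem_univ, if_true]
    ring
  have h3 : cf M (v - t • simpleRoot s) (v - t • simpleRoot s) = cf M v v - 2 * t * c + 2 * t ^ 2 := by
    simp only [map_sub, map_smul, LinearMap.sub_apply, LinearMap.smul_apply, cf_simple_simple,
      coxEntry_self, smul_eq_mul]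
    rw [cf_comm M (simpleRoot s) v]
    ring
  rw [h2, h3, heq] at h1
  have h4 : t * (2 * c) ≤ t * (2 * l * v s + t * (2 - l)) := by nlinarith
  have h5 := le_of_mul_le_mul_left h4 ht0
  have h6 : l * v s ≤ 0 := mul_nonpos_of_nonpos_of_nonneg hl hpos.le
  nlinarith

/-- Indices where some element of `K` is strictly negative. -/
def jSet (M : CoxeterMatrix B) : Set B := {i | ∃ y ∈ coneK M, cf M y (simpleRoot i) < 0}

lemma jSet_closed : ∀ s ∈ jSet M, ∀ t ∉ jSet M, coxEntry M s t = 0 := by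
  rintro s ⟨y, hy, hys⟩ t ht
  by_contra h0
  have hst : s ≠ t := by
    rintro rfl
    exact ht ⟨y, hy, hys⟩
  have hlt : coxEntry M s t < 0 := lt_of_le_of_ne (coxEntry_nonpos M hst) h0
  apply ht
  rw [mem_coneK] at hy
  set d := - cf M y (simpleRoot s) / 2 with hd
  have hd0 : 0 < d := by rw [hd]; linarith
  have e : ∀ i, cf M (y + d • simpleRoot s) (simpleRoot i) =
      cf M y (simpleRoot i) + d * coxEntry M s i := by
    intro i
    simp [cf_simple_simple]
  refine ⟨y + d • simpleRoot s, mem_coneK.2 ⟨?_, fun i => ?_⟩, ?_⟩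
  · exact add_nonneg hy.1 (smul_nonneg hd0.le (simpleRoot_nonneg s))
  · rw [e]
    by_cases hi : i = s
    · rw [hi, coxEntry_self]; linarith
    · have := hy.2 i
      have := mul_nonpos_of_nonneg_of_nonpos hd0.le (coxEntry_nonpos M (Ne.symm hi))
      linarith
  · rw [e]
    have := hy.2 t
    nlinarith

lemma exists_jVec (M : CoxeterMatrix B) :
    ∃ y ∈ coneK M, ∀ i ∈ jSet M, cf M y (simpleRoot i) < 0 := by
  have : ∀ i, ∃ y ∈ coneK M, i ∈ jSet M → cf M y (simpleRoot i) < 0 := by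
    intro i
    by_cases hi : i ∈ jSet M
    · obtain ⟨y, hy, hh⟩ := hi
      exact ⟨y, hy, fun _ => hh⟩
    · exact ⟨0, mem_coneK.2 ⟨le_refl _, by simp⟩, fun h => absurd h hi⟩
  choose f hf1 hf2 using this
  have e : ∀ s, cf M (∑ i, f i) (simpleRoot s) = ∑ i, cf M (f i) (simpleRoot s) := by
    intro s; simp [map_sum]
  refine ⟨∑ i, f i, mem_coneK.2 ⟨Finset.sum_nonneg fun i _ => (hf1 i).1, fun s => ?_⟩, ?_⟩
  · rw [e]
    exact Finset.sum_nonpos fun i _ => (hf1 i).2 s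
  · intro s hs
    rw [e]
    exact Finset.sum_neg' (fun i _ => (hf1 i).2 s) ⟨s, Finset.mem_univ s, hf2 s hs⟩

lemma psd_off_jSet {u : B → ℝ} (hu : 0 ≤ u) (hs : ∀ i ∈ jSet M, u i = 0) : 0 ≤ cf M u u := by
  by_contra! hneg
  let q : (B → ℝ) → ℝ := fun v => ∑ i, v i ^ 2
  have hq : Continuous q := by simp only [q]; fun_prop
  have hq0 : ∀ v, 0 ≤ q v := fun v => Finset.sum_nonneg fun i _ => sq_nonneg _
  have hqz : ∀ v, q v = 0 → v = 0 := by
    intro v hv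
    ext i
    have := (Finset.sum_eq_zero_iff_of_nonneg (fun i _ => sq_nonneg (v i))).1 hv i
      (Finset.mem_univ i)
    simpa using this
  have hqs : ∀ (c : ℝ) v, q (c • v) = c ^ 2 * q v := by
    intro c v
    simp only [q, Finset.mul_sum, Pi.smul_apply, smul_eq_mul, mul_pow]
  have hcs : ∀ (c : ℝ) v, cf M (c • v) (c • v) = c ^ 2 * cf M v v := by
    intro c v
    simp only [map_smul, LinearMap.smul_apply, smul_eq_mul]; ring
  let T : Set (B → ℝ) := {v | 0 ≤ v ∧ (∀ i ∈ jSet M, v i = 0) ∧ q v = 1}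
  have hnorm : ∀ v : B → ℝ, 0 ≤ v → (∀ i ∈ jSet M, v i = 0) → q v ≠ 0 →
      (√(q v))⁻¹ • v ∈ T := by
    intro v h1 h2 h3
    refine ⟨smul_nonneg (by positivity) h1, fun i hi => by simp [h2 i hi], ?_⟩
    rw [hqs, inv_pow, Real.sq_sqrt (hq0 v), inv_mul_cancel₀ h3]
  have hT : IsCompact T := by
    refine Metric.isCompact_of_isClosed_isBounded ?_ ?_
    · have hc1 : IsClosed {v : B → ℝ | ∀ i ∈ jSet M, v i = 0} := by
        simp only [Set.setOf_forall]
        exact isClosed_iInter fun i => isClosed_iInter fun _ =>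
          isClosed_eq (continuous_apply i) continuous_const
      exact (isClosed_le continuous_const continuous_id).inter (hc1.inter
        (isClosed_eq hq continuous_const))
    · refine (Metric.isBounded_closedBall (x := 0) (r := 1)).subset ?_
      rintro v ⟨-, -, hv⟩
      rw [mem_closedBall_zero_iff]
      refine (pi_norm_le_iff_of_nonneg zero_le_one).2 fun i => ?_
      rw [Real.norm_eq_abs, ← sq_le_one_iff_abs_le_one, ← hv]
      exact Finset.single_le_sum (f := fun i => v i ^ 2) (fun j _ => sq_nonneg _)
        (Finset.mem_univ i)
  have hqu : q u ≠ 0 := by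
    intro h
    rw [hqz u h] at hneg
    simp at hneg
  have hcont : Continuous fun v => cf M v v :=
    cf_cont.comp (f := fun v : B → ℝ => (v, v)) (by fun_prop)
  obtain ⟨v, hvT, hvmin⟩ := hT.exists_isMinOn ⟨_, hnorm u hu hs hqu⟩ hcont.continuousOn
  have hmin : ∀ a : B → ℝ, 0 ≤ a → (∀ i ∈ jSet M, a i = 0) → cf M v v * q a ≤ cf M a a := by
    intro a h1 h2
    by_cases h3 : q a = 0
    · rw [hqz a h3]; simp [q]
    · have h4 : cf M v v ≤ _ := hvmin (hnorm a h1 h2 h3)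
      simp only [hcs, inv_pow, Real.sq_sqrt (hq0 a)] at h4
      have h5 : 0 < q a := lt_of_le_of_ne (hq0 a) (Ne.symm h3)
      rwa [inv_mul_eq_div, le_div_iff₀ h5] at h4
  have hvneg : cf M v v < 0 := by
    have := hmin u hu hs
    have h5 : 0 < q u := lt_of_le_of_ne (hq0 u) (Ne.symm hqu)
    by_contra! h6
    have := mul_nonneg h6 h5.le
    linarith
  have hvK : v ∈ coneK M := by
    refine kkt jSet_closed hvT.1 hvT.2.1 hvneg.le ?_ hmin
    have : ∑ i, v i ^ 2 = 1 := hvT.2.2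
    rw [this, mul_one]
  have : cf M v v = 0 := by
    rw [cf_eq_sum_right]
    refine Finset.sum_eq_zero fun i _ => ?_
    by_cases hi : i ∈ jSet M
    · rw [hvT.2.1 i hi, zero_mul]
    · have h1 : ¬ cf M v (simpleRoot i) < 0 := fun h => hi ⟨v, hvK, h⟩
      have h2 := (mem_coneK.1 hvK).2 i
      rw [le_antisymm h2 (not_lt.1 h1), mul_zero]
  linarith

open Classical in
/-- Projection killing the coordinates in `jSet`. -/
noncomputable def prj (M : CoxeterMatrix B) (v : B → ℝ) : B → ℝ :=
  fun i => if i ∈ jSet M then 0 else v i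

lemma prj_cont : Continuous (prj M) := by
  refine continuous_pi fun i => ?_
  unfold prj
  split_ifs <;> fun_prop

lemma prj_nonneg {v : B → ℝ} (hv : 0 ≤ v) : 0 ≤ prj M v := by
  intro i
  unfold prj
  split_ifs
  · exact le_refl _
  · exact hv i

lemma prj_simple_mem {s : B} (hs : s ∈ jSet M) : prj M (simpleRoot s) = 0 := by
  ext i
  unfold prj simpleRoot
  split_ifs with hi
  · rfl
  · have : i ≠ s := fun h => hi (h ▸ hs)
    simp [this]

lemma prj_simple_notMem {s : B} (hs : s ∉ jSet M) : prj M (simpleRoot s) = simpleRoot s := by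
  ext i
  unfold prj simpleRoot
  split_ifs with hi
  · have : i ≠ s := fun h => hs (h ▸ hi)
    simp [this]
  · rfl

lemma prj_sub_smul (a b : B → ℝ) (c : ℝ) : prj M (a - c • b) = prj M a - c • prj M b := by
  ext i
  simp only [prj, Pi.sub_apply, Pi.smul_apply]
  split_ifs <;> simp

lemma cf_prj_mem {s : B} (hs : s ∈ jSet M) (v : B → ℝ) : cf M (prj M v) (simpleRoot s) = 0 := by
  rw [cf_simple_eq_sum]
  refine Finset.sum_eq_zero fun i _ => ?_
  by_cases hi : i ∈ jSet M
  · simp [prj, hi]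
  · rw [jSet_closed s hs i hi, mul_zero]

lemma cf_prj_notMem {s : B} (hs : s ∉ jSet M) (v : B → ℝ) :
    cf M (prj M v) (simpleRoot s) = cf M v (simpleRoot s) := by
  rw [cf_simple_eq_sum, cf_simple_eq_sum]
  refine Finset.sum_congr rfl fun i _ => ?_
  by_cases hi : i ∈ jSet M
  · rw [coxEntry_comm, jSet_closed i hi s hs, mul_zero, mul_zero]
  · simp [prj, hi]

lemma IsTits.prj_rho (h : IsTits M cs ρ) (w : W) (v : B → ℝ) :
    prj M (ρ w v) = ρ w (prj M v) := by
  induction w using cs.simple_induction_left with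
  | one => simp
  | mul_simple_left w s ih =>
    rw [rho_mul, rho_mul, ← ih, h.app, h.app, prj_sub_smul]
    by_cases hs : s ∈ jSet M
    · rw [prj_simple_mem hs, cf_prj_mem hs, smul_zero, zero_smul]
    · rw [prj_simple_notMem hs, cf_prj_notMem hs]

lemma IsTits.prj_pCone (h : IsTits M cs ρ) {x : B → ℝ} (hx : x ∈ pCone ρ) :
    prj M x ∈ pCone ρ := by
  intro w
  rw [← h.prj_rho]
  exact prj_nonneg (hx w)

lemma IsTits.cf_notMem (h : IsTits M cs ρ) {x : B → ℝ} (hx : x ∈ pCone ρ) {s : B}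
    (hs : s ∉ jSet M) : cf M x (simpleRoot s) ≤ 0 := by
  have h1 := h.prj_pCone hx
  have h2 := h.cf_pCone h1 h1
  have h3 : ∀ i ∈ jSet M, prj M x i = 0 := fun i hi => by simp [prj, hi]
  have h4 := psd_off_jSet (pCone_nonneg h1) h3
  have h5 : prj M x ∈ coneK M := by
    refine kkt (l := 0) jSet_closed (pCone_nonneg h1) h3 le_rfl ?_ ?_
    · rw [zero_mul]; exact le_antisymm h2 h4
    · intro u hu hu'
      rw [zero_mul]; exact psd_off_jSet hu hu'
  rw [← cf_prj_notMem hs]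
  exact (mem_coneK.1 h5).2 s

lemma IsTits.pCone_sub (h : IsTits M cs ρ) : pCone ρ ⊆ imagCone M ρ := by
  intro x hx
  obtain ⟨y, hyK, hyJ⟩ := exists_jVec M
  have hy := h.coneK_sub hyK
  have key : ∀ e : ℝ, 0 < e → x + e • y ∈ {v | ∃ (w : W), ∃ k ∈ coneK M, v = ρ w k} := by
    intro e he
    have hx' : x + e • y ∈ pCone ρ := pCone_add hx (pCone_smul hy he.le)
    set x' := x + e • y with hx'def
    have hfin : {β | β ∈ posRootSet ρ ∧ (- cf M x') β < 0}.Finite := by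
      by_contra hinf
      obtain ⟨u, huP, hu1, hucl⟩ := h.limit_root (fun β hβ => hβ.1) hinf
      have hcl : IsClosed {u : B → ℝ | prj M u = 0 ∧ 0 ≤ cf M x' u} := by
        have c2 : IsClosed {u : B → ℝ | 0 ≤ cf M x' u} :=
          isClosed_le continuous_const (LinearMap.continuous_of_finiteDimensional _)
        exact (isClosed_eq prj_cont continuous_const).inter c2
      have hu2 : prj M u = 0 ∧ 0 ≤ cf M x' u := by
        refine closure_minimal ?_ hcl hucl
        rintro _ ⟨β, ⟨hβ, hβ2⟩, rfl⟩
        have hβ3 : 0 < cf M x' β := by simpa using hβ2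
        have hβ4 : prj M β = 0 := by
          obtain ⟨⟨w, s, hws⟩, hβp⟩ := hβ
          by_cases hs : s ∈ jSet M
          · rw [hws, h.prj_rho, prj_simple_mem hs, map_zero]
          · exfalso
            have hpr : prj M β = β := by rw [hws, h.prj_rho, prj_simple_notMem hs]
            rw [cf_eq_sum_right] at hβ3
            refine absurd hβ3 (not_lt.2 (Finset.sum_nonpos fun i _ => ?_))
            by_cases hi : i ∈ jSet M
            · have : β i = 0 := by rw [← hpr]; simp [prj, hi]
              rw [this, zero_mul]
            · exact mul_nonpos_of_nonneg_of_nonpos (hβp i) (h.cf_notMem hx' hi)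
        constructor
        · have := prj_sub_smul (M := M) 0 β (-‖β‖⁻¹)
          rw [hβ4] at this
          simp only [neg_smul, zero_sub, neg_neg, smul_zero, sub_zero] at this
          show prj M (‖β‖⁻¹ • β) = 0
          rw [this]
          ext i; simp [prj]
        · show 0 ≤ cf M x' (‖β‖⁻¹ • β)
          rw [map_smul]
          exact smul_nonneg (by positivity) hβ3.le
      have h1 := h.cf_pCone hx huP
      have h2 : cf M y u < 0 := by
        rw [cf_eq_sum_right]
        have hu0 := pCone_nonneg huP
        refine Finset.sum_neg' (fun i _ => mul_nonpos_of_nonneg_of_nonpos (hu0 i)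
          ((mem_coneK.1 hyK).2 i)) ?_
        have hune : u ≠ 0 := by rintro rfl; simp at hu1
        obtain ⟨i, hi⟩ := Function.ne_iff.1 hune
        refine ⟨i, Finset.mem_univ i, ?_⟩
        have hiJ : i ∈ jSet M := by
          by_contra hiJ
          have := congrFun hu2.1 i
          simp [prj, hiJ] at this
          exact hi this
        exact mul_neg_of_pos_of_neg (lt_of_le_of_ne (hu0 i) (Ne.symm hi)) (hyJ i hiJ)
      have h3 := hu2.2
      simp only [hx'def, map_add, map_smul, LinearMap.add_apply, LinearMap.smul_apply,
        smul_eq_mul] at h3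
      have := mul_neg_of_pos_of_neg he h2
      linarith
    obtain ⟨w, hw⟩ := h.exists_chamber _ _ hfin rfl
    refine ⟨w, ρ w⁻¹ x', mem_coneK.2 ⟨hx' _, fun s => ?_⟩, (rho_self_inv ρ w x').symm⟩
    have h1 := hw s
    rw [LinearMap.neg_apply] at h1
    rw [← h.cf_inv w, rho_self_inv]
    linarith
  have hl : Filter.Tendsto (fun e : ℝ => x + e • y) (nhdsWithin 0 (Set.Ioi 0))
      (nhds (x + (0 : ℝ) • y)) :=
    Filter.Tendsto.mono_left (Continuous.tendsto (by fun_prop) 0) nhdsWithin_le_nhds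
  rw [zero_smul, add_zero] at hl
  exact mem_closure_of_tendsto hl (by
    filter_upwards [self_mem_nhdsWithin] with e he using key e he)

/-- The pairing as a linear map. -/
noncomputable def evL (z : B → ℂ) : (B → ℝ) →ₗ[ℝ] ℂ where
  toFun := evalC z
  map_add' a b := by simp [evalC, add_mul, Finset.sum_add_distrib]
  map_smul' t a := by simp [evalC, Finset.mul_sum, mul_assoc]

lemma evL_apply (z : B → ℂ) (v : B → ℝ) : evL z v = evalC z v := rfl

lemma evL_sub (z z' : B → ℂ) (v : B → ℝ) : evL (z - z') v = evL z v - evL z' v := by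
  simp [evL_apply, evalC, mul_sub, Finset.sum_sub_distrib]

lemma evL_bound (z : B → ℂ) (v : B → ℝ) : ‖evL z v‖ ≤ Fintype.card B * ‖z‖ * ‖v‖ := by
  rw [evL_apply, evalC]
  refine (norm_sum_le _ _).trans ?_
  calc ∑ i, ‖(v i : ℂ) * z i‖ ≤ ∑ _i : B, ‖v‖ * ‖z‖ := by
        refine Finset.sum_le_sum fun i _ => ?_
        rw [norm_mul, Complex.norm_real]
        exact mul_le_mul (norm_le_pi_norm v i) (norm_le_pi_norm z i) (norm_nonneg _) (norm_nonneg _)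
    _ = _ := by simp; ring

lemma evL_wact (w : W) (z : B → ℂ) (v : B → ℝ) : evL (wact ρ w z) v = evL z (ρ w⁻¹ v) := by
  conv_rhs => rw [vec_eq_sum v]
  simp only [map_sum, map_smul]
  simp only [evL_apply, evalC, wact]
  simp

lemma exists_lower (L : (B → ℝ) →ₗ[ℝ] ℝ) (hL : ∀ v ∈ pCone ρ, v ≠ 0 → 0 < L v) :
    ∃ c > 0, ∀ v ∈ pCone ρ, c * ‖v‖ ≤ L v := by
  have hc : Continuous L := LinearMap.continuous_of_finiteDimensional _
  have hK : IsCompact (pCone ρ ∩ Metric.sphere (0 : B → ℝ) 1) :=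
    (isCompact_sphere 0 1).inter_left pCone_closed
  rcases (pCone ρ ∩ Metric.sphere (0 : B → ℝ) 1).eq_empty_or_nonempty with h0 | h0
  · refine ⟨1, one_pos, fun v hv => ?_⟩
    by_cases h : v = 0
    · simp [h]
    · exfalso
      have : ‖v‖⁻¹ • v ∈ pCone ρ ∩ Metric.sphere (0 : B → ℝ) 1 := by
        refine ⟨pCone_smul hv (by positivity), ?_⟩
        rw [mem_sphere_zero_iff_norm, norm_smul, norm_inv, norm_norm,
          inv_mul_cancel₀ (norm_ne_zero_iff.2 h)]
      rw [h0] at this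
      exact this
  · obtain ⟨x, ⟨hxP, hx1⟩, hx⟩ := hK.exists_isMinOn h0 hc.continuousOn
    have hx0 : x ≠ 0 := by
      rintro rfl
      simp at hx1
    refine ⟨L x, hL x hxP hx0, fun v hv => ?_⟩
    by_cases h : v = 0
    · simp [h]
    · have hn : 0 < ‖v‖ := norm_pos_iff.2 h
      have : ‖v‖⁻¹ • v ∈ pCone ρ ∩ Metric.sphere (0 : B → ℝ) 1 := by
        refine ⟨pCone_smul hv (by positivity), ?_⟩
        rw [mem_sphere_zero_iff_norm, norm_smul, norm_inv, norm_norm,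
          inv_mul_cancel₀ (norm_ne_zero_iff.2 h)]
      have h2 : L x ≤ L (‖v‖⁻¹ • v) := hx this
      rw [map_smul, smul_eq_mul] at h2
      calc L x * ‖v‖ ≤ (‖v‖⁻¹ * L v) * ‖v‖ := by gcongr
        _ = L v := by field_simp

lemma exists_sep (z : B → ℂ) (hz : ∀ v ∈ pCone ρ, v ≠ 0 → evL z v ≠ 0) :
    ∃ f : ℂ →L[ℝ] ℝ, f ≠ 0 ∧ ∀ v ∈ pCone ρ, v ≠ 0 → 0 < f (evL z v) := by
  have hpos : ∀ v ∈ pCone ρ, v ≠ 0 → 0 < ht v := fun v hv h0 =>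
    (norm_pos_iff.2 h0).trans_le (norm_le_ht (pCone_nonneg hv))
  let T : Set (B → ℝ) := pCone ρ ∩ {v | ht v = 1}
  have hTc : IsCompact T := by
    refine Metric.isCompact_of_isClosed_isBounded
      (pCone_closed.inter (isClosed_eq ht_cont continuous_const)) ?_
    refine (Metric.isBounded_closedBall (x := 0) (r := 1)).subset ?_
    rintro v ⟨hv, hv1⟩
    rw [mem_closedBall_zero_iff]
    exact (norm_le_ht (pCone_nonneg hv)).trans (le_of_eq hv1)
  have hTv : Convex ℝ T := by
    rintro a ⟨ha, ha1⟩ b ⟨hb, hb1⟩ s t hs ht' hst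
    refine ⟨pCone_add (pCone_smul ha hs) (pCone_smul hb ht'), ?_⟩
    rw [Set.mem_setOf_eq] at ha1 hb1 ⊢
    rw [map_add, map_smul, map_smul, ha1, hb1]; simpa using hst
  have hnorm : ∀ v ∈ pCone ρ, v ≠ 0 → (ht v)⁻¹ • v ∈ T := by
    intro v hv h0
    have := hpos v hv h0
    refine ⟨pCone_smul hv (by positivity), ?_⟩
    rw [Set.mem_setOf_eq, map_smul, smul_eq_mul, inv_mul_cancel₀ this.ne']
  rcases T.eq_empty_or_nonempty with h0 | ⟨x, hx⟩
  · refine ⟨Complex.reCLM, ?_, ?_⟩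
    · intro h
      have := congrArg (fun f : ℂ →L[ℝ] ℝ => f 1) h
      simp at this
    · intro v hv hv0
      have := hnorm v hv hv0
      rw [h0] at this
      exact this.elim
  · have hcl : IsClosed (evL z '' T) :=
      (hTc.image (LinearMap.continuous_of_finiteDimensional (evL z))).isClosed
    have hn0 : (0 : ℂ) ∉ evL z '' T := by
      rintro ⟨v, ⟨hv, hv1⟩, hv0⟩
      refine hz v hv ?_ hv0
      rintro rfl
      simp at hv1
    obtain ⟨f, u, hu, hf⟩ := geometric_hahn_banach_point_closed (hTv.linear_image (evL z)) hcl hn0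
    rw [map_zero] at hu
    have hfT : ∀ v ∈ T, 0 < f (evL z v) := fun v hv => hu.trans (hf _ ⟨v, hv, rfl⟩)
    refine ⟨f, ?_, ?_⟩
    · rintro rfl
      have := hfT x hx
      simp at this
    · intro v hv hv0
      have h1 := hfT _ (hnorm v hv hv0)
      rw [map_smul, map_smul, smul_eq_mul] at h1
      exact (mul_pos_iff_of_pos_left (inv_pos.2 (hpos v hv hv0))).1 h1

lemma IsTits.countable (_h : IsTits M cs ρ) : (posRootSet ρ).Countable := by
  have hW : Countable W := cs.wordProd_surjective.countable
  refine Set.Countable.mono (s₂ := Set.range fun p : W × B => ρ p.1 (simpleRoot p.2)) ?_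
    (Set.countable_range _)
  rintro v ⟨⟨w, s, rfl⟩, -⟩
  exact ⟨(w, s), rfl⟩

lemma IsTits.exists_generic (h : IsTits M cs ρ) (z : B → ℂ)
    (hz : ∀ v ∈ pCone ρ, v ≠ 0 → evL z v ≠ 0) (hz2 : ∀ β ∈ posRootSet ρ, evL z β ≠ 0) :
    ∃ f : ℂ →L[ℝ] ℝ, (∀ v ∈ pCone ρ, v ≠ 0 → 0 < f (evL z v)) ∧
      ∀ β ∈ posRootSet ρ, f (evL z β) ≠ 0 := by
  obtain ⟨f, hf0, hf⟩ := exists_sep z hz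
  have hform : ∀ x : ℂ, f x = x.re * f 1 + x.im * f Complex.I := by
    intro x
    conv_lhs => rw [show x = x.re • (1 : ℂ) + x.im • Complex.I by
      simp [Complex.re_add_im]]
    rw [map_add, map_smul, map_smul, smul_eq_mul, smul_eq_mul]
  let g : ℂ →L[ℝ] ℝ := f.comp ((ContinuousLinearMap.mul ℝ ℂ) Complex.I)
  have hg : ∀ x, g x = f (Complex.I * x) := fun x => rfl
  have hfg : ∀ x, f x = 0 → g x = 0 → x = 0 := by
    intro x h1 h2
    have hne : f 1 ^ 2 + f Complex.I ^ 2 ≠ 0 := by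
      intro h3
      apply hf0
      have e1 : f 1 = 0 := by nlinarith [sq_nonneg (f 1), sq_nonneg (f Complex.I)]
      have e2 : f Complex.I = 0 := by nlinarith [sq_nonneg (f 1), sq_nonneg (f Complex.I)]
      ext y
      rw [hform, e1, e2]
      simp
    rw [hg, hform] at h2
    rw [hform] at h1
    simp at h2
    apply Complex.ext
    · refine (mul_eq_zero.1 (?_ : x.re * (f 1 ^ 2 + f Complex.I ^ 2) = 0)).resolve_right hne
      linear_combination f 1 * h1 + f Complex.I * h2
    · refine (mul_eq_zero.1 (?_ : x.im * (f 1 ^ 2 + f Complex.I ^ 2) = 0)).resolve_right hne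
      linear_combination f Complex.I * h1 - f 1 * h2
  obtain ⟨c, hc, hcb⟩ := exists_lower (ρ := ρ) (f.toLinearMap.comp (evL z)) hf
  let K : ℝ := ‖g‖ * (Fintype.card B * ‖z‖) + 1
  have hK : 0 < K := by positivity
  have hgb : ∀ v, |g (evL z v)| ≤ K * ‖v‖ := by
    intro v
    have h1 := g.le_opNorm (evL z v)
    have h2 := mul_le_mul_of_nonneg_left (evL_bound z v) (norm_nonneg g)
    rw [Real.norm_eq_abs] at h1
    have h3 := norm_nonneg v
    simp only [K]
    nlinarith
  have hcount : (⋃ β ∈ posRootSet ρ, {t : ℝ | f (evL z β) + t * g (evL z β) = 0}).Countable := by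
    refine h.countable.biUnion fun β hβ => Set.Subsingleton.countable ?_
    intro t ht' s hs
    rw [Set.mem_setOf_eq] at ht' hs
    have h1 : (t - s) * g (evL z β) = 0 := by linear_combination ht' - hs
    rcases mul_eq_zero.1 h1 with h2 | h2
    · linarith
    · rw [h2] at ht'
      exact (hz2 β hβ (hfg _ (by simpa using ht') h2)).elim
  have hunc : ¬ (Set.Ioo (0 : ℝ) (c / K)).Countable := by
    intro hcn
    have := hcn.measure_zero MeasureTheory.volume
    rw [Real.volume_Ioo] at this
    simp at this
    exact absurd this (not_le.2 (by positivity))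
  obtain ⟨t, ht', htn⟩ : ∃ t ∈ Set.Ioo (0 : ℝ) (c / K),
      t ∉ ⋃ β ∈ posRootSet ρ, {t : ℝ | f (evL z β) + t * g (evL z β) = 0} := by
    by_contra hcon
    push Not at hcon
    exact hunc (hcount.mono hcon)
  refine ⟨f + t • g, ?_, ?_⟩
  · intro v hv hv0
    have hn : 0 < ‖v‖ := norm_pos_iff.2 hv0
    have h1 : c * ‖v‖ ≤ f (evL z v) := hcb v hv
    have h2 := hgb v
    have h3 : t * K < c := (lt_div_iff₀ hK).1 ht'.2
    have h4 : - (K * ‖v‖) ≤ g (evL z v) := (abs_le.1 h2).1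
    have h5 := mul_le_mul_of_nonneg_left h4 ht'.1.le
    have h6 := mul_lt_mul_of_pos_right h3 hn
    simp only [ContinuousLinearMap.add_apply, ContinuousLinearMap.smul_apply, smul_eq_mul]
    nlinarith
  · intro β hβ h1
    exact htn (Set.mem_biUnion hβ (by simpa using h1))

lemma IsTits.exists_bound (h : IsTits M cs ρ) (L : (B → ℝ) →ₗ[ℝ] ℝ)
    (hL : ∀ v ∈ pCone ρ, v ≠ 0 → 0 < L v) (hL2 : ∀ β ∈ posRootSet ρ, L β ≠ 0) :
    {β | β ∈ posRootSet ρ ∧ L β < 0}.Finite ∧ ∃ c > 0, (∀ v ∈ pCone ρ, c * ‖v‖ ≤ L v) ∧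
      ∀ β ∈ posRootSet ρ, c * ‖β‖ ≤ |L β| := by
  obtain ⟨c, hc, hcb⟩ := exists_lower L hL
  have hLc : Continuous L := LinearMap.continuous_of_finiteDimensional _
  have hfin : {β | β ∈ posRootSet ρ ∧ L β < c / 2 * ‖β‖}.Finite := by
    by_contra hinf
    obtain ⟨u, huP, hu1, hucl⟩ := h.limit_root (fun β hβ => hβ.1) hinf
    have hcl : IsClosed {u : B → ℝ | L u ≤ c / 2} := isClosed_le hLc continuous_const
    have hu2 : L u ≤ c / 2 := by
      refine closure_minimal ?_ hcl hucl
      rintro _ ⟨β, ⟨hβ, hβ2⟩, rfl⟩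
      have hn : 0 < ‖β‖ := norm_pos_iff.2 (h.root_ne_zero hβ.1)
      simp only [Set.mem_setOf_eq, map_smul, smul_eq_mul]
      rw [inv_mul_le_iff₀ hn]
      linarith
    have := hcb u huP
    rw [hu1] at this
    linarith
  refine ⟨hfin.subset ?_, ?_⟩
  · rintro β ⟨hβ, hβ2⟩
    exact ⟨hβ, hβ2.trans_le (by positivity)⟩
  · have hex : ∃ d > 0, ∀ β ∈ {β | β ∈ posRootSet ρ ∧ L β < c / 2 * ‖β‖}, d * ‖β‖ ≤ |L β| := by
      refine Set.Finite.induction_on_subset _ hfin ⟨1, one_pos, by simp⟩ ?_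
      rintro a S ha hS haS ⟨d, hd, hdS⟩
      have hn : 0 < ‖a‖ := norm_pos_iff.2 (h.root_ne_zero ha.1.1)
      have hLa : 0 < |L a| := abs_pos.2 (hL2 a ha.1)
      refine ⟨min d (|L a| / ‖a‖), by positivity, ?_⟩
      rintro β (rfl | hβ)
      · calc _ ≤ |L β| / ‖β‖ * ‖β‖ := by gcongr; exact min_le_right _ _
          _ = _ := by field_simp
      · refine le_trans ?_ (hdS β hβ)
        gcongr; exact min_le_left _ _
    obtain ⟨d, hd, hdb⟩ := hex
    refine ⟨min d (c / 2), by positivity, ?_, ?_⟩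
    · intro v hv
      refine le_trans ?_ (hcb v hv)
      gcongr
      exact (min_le_right _ _).trans (by linarith)
    · intro β hβ
      by_cases hb : L β < c / 2 * ‖β‖
      · refine le_trans ?_ (hdb β ⟨hβ, hb⟩)
        gcongr; exact min_le_left _ _
      · push Not at hb
        refine le_trans ?_ (hb.trans (le_abs_self _))
        gcongr; exact min_le_right _ _

/-- A functional positive on the simple roots determines the chamber. -/
lemma IsTits.eq_one_of_pos (h : IsTits M cs ρ) (k : (B → ℝ) →ₗ[ℝ] ℝ) (g : W)
    (hk : ∀ s, 0 < k (simpleRoot s)) (hg : ∀ s, 0 < k (ρ g (simpleRoot s))) : g = 1 := by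
  by_contra hne
  obtain ⟨s, hs⟩ := cs.exists_rightDescent_of_ne_one hne
  have h1 := h.neg_of_desc (cs.isRightDescent_iff.1 hs)
  have h2 : k (ρ g (simpleRoot s)) ≤ 0 := by
    rw [vec_eq_sum (ρ g (simpleRoot s)), map_sum]
    refine Finset.sum_nonpos fun i _ => ?_
    rw [map_smul, smul_eq_mul]
    exact mul_nonpos_of_nonpos_of_nonneg (h1 i) (hk i).le
  exact absurd (hg s) (not_lt.2 h2)

lemma IsTits.main (h : IsTits M cs ρ) (z : B → ℂ) (hz : z ∈ upsReg M ρ) :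
    ∃ U : Set (B → ℂ), U ⊆ upsReg M ρ ∧ IsOpen U ∧ z ∈ U ∧
        ∀ w : W, w ≠ 1 → Disjoint (wact ρ w '' U) U := by
  obtain ⟨f, hf1, hf2⟩ := h.exists_generic z
    (fun v hv hv0 => hz.1 v (h.pCone_sub hv) hv0) (fun β hβ => hz.2 β hβ)
  let F : (B → ℂ) → (B → ℝ) →ₗ[ℝ] ℝ := fun z => f.toLinearMap.comp (evL z)
  have hF : ∀ z v, F z v = f (evL z v) := fun _ _ => rfl
  obtain ⟨hfin, c, hc, hcP, hcR⟩ := h.exists_bound (F z) hf1 hf2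
  let K : ℝ := ‖f‖ * Fintype.card B + 1
  have hK : 0 < K := by positivity
  have hdiff : ∀ z' ∈ Metric.ball z (c / K), ∀ v, v ≠ 0 → |F z' v - F z v| < c * ‖v‖ := by
    intro z' hz' v hv
    have hn : 0 < ‖v‖ := norm_pos_iff.2 hv
    rw [mem_ball_iff_norm, lt_div_iff₀ hK] at hz'
    rw [hF, hF, ← map_sub, ← evL_sub]
    have h1 := f.le_opNorm (evL (z' - z) v)
    have h2 := mul_le_mul_of_nonneg_left (evL_bound (z' - z) v) (norm_nonneg f)
    rw [Real.norm_eq_abs] at h1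
    have h3 := mul_lt_mul_of_pos_right hz' hn
    have h4 : 0 ≤ ‖z' - z‖ * ‖v‖ := by positivity
    simp only [K] at h3
    nlinarith
  have hposP : ∀ z' ∈ Metric.ball z (c / K), ∀ v ∈ pCone ρ, v ≠ 0 → 0 < F z' v := by
    intro z' hz' v hv hv0
    have h1 := (abs_lt.1 (hdiff z' hz' v hv0)).1
    have h2 := hcP v hv
    linarith
  have hroot : ∀ β ∈ rootSet ρ, c * ‖β‖ ≤ |F z β| := by
    intro β hβ
    rcases h.pos_or_neg hβ with h1 | h1
    · exact hcR β ⟨hβ, h1⟩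
    · have h2 : -β ∈ posRootSet ρ := by
        refine ⟨?_, fun i => by simpa using h1 i⟩
        obtain ⟨w, s, rfl⟩ := hβ
        exact ⟨w * cs.simple s, s, by rw [rho_mul, h.simple_self, map_neg]⟩
      simpa using hcR _ h2
  have hpos : ∀ z' ∈ Metric.ball z (c / K), ∀ β ∈ rootSet ρ, 0 ≤ F z β → 0 < F z' β := by
    intro z' hz' β hβ h0
    have h1 := (abs_lt.1 (hdiff z' hz' β (h.root_ne_zero hβ))).1
    have h2 := hroot β hβ
    rw [abs_of_nonneg h0] at h2
    linarith
  have hne : ∀ z' ∈ Metric.ball z (c / K), ∀ β ∈ rootSet ρ, F z' β ≠ 0 := by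
    intro z' hz' β hβ h0
    have h1 := hdiff z' hz' β (h.root_ne_zero hβ)
    have h2 := hroot β hβ
    rw [h0, zero_sub, abs_neg] at h1
    linarith
  refine ⟨Metric.ball z (c / K), ?_, Metric.isOpen_ball,
    Metric.mem_ball_self (by positivity), ?_⟩
  · intro z' hz'
    refine ⟨fun v hv hv0 h0 => ?_, fun β hβ h0 => ?_⟩
    · have := hposP z' hz' v (h.imagCone_sub hv) hv0
      rw [hF, evL_apply, h0, map_zero] at this
      exact lt_irrefl _ this
    · refine hne z' hz' β hβ.1 ?_
      rw [hF, evL_apply, h0, map_zero]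
  · intro w hw
    rw [Set.disjoint_left]
    rintro _ ⟨z', hz', rfl⟩ hz''
    apply hw
    obtain ⟨w0, hw0⟩ := h.exists_chamber _ (F z) hfin rfl
    have hr : ∀ s, ρ w0 (simpleRoot s) ∈ rootSet ρ := fun s => ⟨w0, s, rfl⟩
    have hg : w0⁻¹ * w⁻¹ * w0 = 1 := by
      refine h.eq_one_of_pos ((F z').comp (ρ w0).toLinearMap) _ ?_ ?_
      · intro s
        exact hpos z' hz' _ (hr s) (hw0 s)
      · intro s
        have := hpos _ hz'' _ (hr s) (hw0 s)
        rw [hF, evL_wact] at this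
        change 0 < F z' (ρ w0 (ρ (w0⁻¹ * w⁻¹ * w0) (simpleRoot s)))
        rw [← rho_mul, show w0 * (w0⁻¹ * w⁻¹ * w0) = w⁻¹ * w0 by group, rho_mul]
        exact this
    have h3 : w⁻¹ = 1 := by
      calc w⁻¹ = w0 * (w0⁻¹ * w⁻¹ * w0) * w0⁻¹ := by group
        _ = 1 := by rw [hg]; group
    exact inv_eq_one.1 h3

end Helpers

/-!
STATEMENT 13: The action of W on Υ_reg is free and properly discontinuous.
-/
theorem wact_free_and_properlyDiscontinuous
    {B : Type*} [Fintype B] [DecidableEq B] (M : CoxeterMatrix B)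
    {W : Type*} [Group W] (cs : CoxeterSystem M W)
    (ρ : W →* ((B → ℝ) ≃ₗ[ℝ] (B → ℝ)))
    (hρ : ∀ (s : B) (v : B → ℝ),
      ρ (cs.simple s) v = v - coxForm M (simpleRoot s) v • simpleRoot s) :
    (∀ (w : W), ∀ z ∈ upsReg M ρ, wact ρ w z = z → w = 1) ∧
      (∀ z ∈ upsReg M ρ, ∃ U : Set (B → ℂ), U ⊆ upsReg M ρ ∧ IsOpen U ∧ z ∈ U ∧
        ∀ w : W, w ≠ 1 → Disjoint (wact ρ w '' U) U) := by
  have h : IsTits M cs ρ := hρ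
  refine ⟨fun w z hz hwz => ?_, fun z hz => h.main z hz⟩
  by_contra hw
  obtain ⟨U, -, -, hzU, hU⟩ := h.main z hz
  exact Set.disjoint_left.1 (hU w hw) ⟨z, hzU, hwz⟩ hzU
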